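/- The two geometric constants of the construction satisfy 𝔄₀ = 2 𝔄₁; equivalently, (1/2)∫_{ℝ^N₊} ξ_N |∇w₀|² dξ − ((N−2)/(2N)) ∫_{ℝ^N₊} ξ_N w₀^{2N/(N−2)} dξ = 2 ∫_{ℝ^N₊} ξ_N |∂w₀/∂ξ₁|² dξ. -/

import Mathlib

open MeasureTheory

noncomputable section

/-- Partial derivative in the `i`-th coordinate direction. -/
def pd {N : ℕ} (i : Fin N) (f : EuclideanSpace ℝ (Fin N) → ℝ)
    (ξ : EuclideanSpace ℝ (Fin N)) : ℝ :=
  fderiv ℝ f ξ (EuclideanSpace.single i 1)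

/-- The Laplacian, as the sum of the pure second partial derivatives. -/
def lap {N : ℕ} (f : EuclideanSpace ℝ (Fin N) → ℝ)
    (ξ : EuclideanSpace ℝ (Fin N)) : ℝ :=
  ∑ i : Fin N, pd i (pd i f) ξ

/-- The standard bubble `w₀(ξ) = α_N (1+|ξ|²)^{-(N-2)/2}`,
with `α_N = (N(N-2))^{(N-2)/4}`. -/
def w0 (N : ℕ) (ξ : EuclideanSpace ℝ (Fin N)) : ℝ :=
  ((N : ℝ) * ((N : ℝ) - 2)) ^ (((N : ℝ) - 2) / 4) *
    (1 + ‖ξ‖ ^ 2) ^ (-(((N : ℝ) - 2) / 2))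

/-- The index of the last coordinate `ξ_N`. -/
def lastIdx (N : ℕ) (h : 0 < N) : Fin N := ⟨N - 1, Nat.sub_lt h Nat.one_pos⟩

/-- The open upper half space `ℝ^N₊ = {ξ : ξ_N > 0}`. -/
def upperHalf (N : ℕ) (h : 0 < N) : Set (EuclideanSpace ℝ (Fin N)) :=
  {ξ | 0 < ξ (lastIdx N h)}

/-- The function `Z₀(ξ) = ξ·∇w₀(ξ) + ((N-2)/2) w₀(ξ)`. -/
def Zdil (N : ℕ) (ξ : EuclideanSpace ℝ (Fin N)) : ℝ :=
  (∑ i, ξ i * pd i (w0 N) ξ) + ((N : ℝ) - 2) / 2 * w0 N ξ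

open Filter Topology

theorem hasDerivAt_mul_max_zero (u : ℝ) :
    HasDerivAt (fun y : ℝ => y * max y 0) (2 * max u 0) u := by
  rcases lt_trichotomy u 0 with hu | rfl | hu
  · have h : (fun y : ℝ => y * max y 0) =ᶠ[𝓝 u] fun _ => 0 := by
      filter_upwards [Iio_mem_nhds hu] with y hy
      simp [max_eq_right (le_of_lt (Set.mem_Iio.1 hy))]
    rw [max_eq_right hu.le, mul_zero]
    exact (hasDerivAt_const u (0 : ℝ)).congr_of_eventuallyEq h
  · rw [hasDerivAt_iff_tendsto_slope]
    have h : Tendsto (fun y : ℝ => max y 0) (𝓝[≠] 0) (𝓝 (2 * max (0 : ℝ) 0)) := by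
      have : ContinuousAt (fun y : ℝ => max y 0) 0 := by fun_prop
      simpa using this.tendsto.mono_left nhdsWithin_le_nhds
    refine h.congr' ?_
    filter_upwards [self_mem_nhdsWithin] with y hy
    have hy' : y ≠ 0 := hy
    rw [slope_def_field]
    field_simp
    simp
  · have h : (fun y : ℝ => y * max y 0) =ᶠ[𝓝 u] fun y => y ^ 2 := by
      filter_upwards [Ioi_mem_nhds hu] with y hy
      rw [max_eq_left (le_of_lt (Set.mem_Ioi.1 hy)), sq]
    rw [max_eq_left hu.le]
    simpa using (hasDerivAt_pow 2 u).congr_of_eventuallyEq h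

theorem hasFDerivAt_one_add_norm_sq_rpow {E : Type*} [NormedAddCommGroup E]
    [InnerProductSpace ℝ E] (s : ℝ) (x : E) :
    HasFDerivAt (fun y : E => (1 + ‖y‖ ^ 2) ^ s)
      ((s * (1 + ‖x‖ ^ 2) ^ (s - 1)) • (2 • innerSL ℝ x)) x :=
  ((hasStrictFDerivAt_norm_sq x).hasFDerivAt.const_add 1).rpow_const
    (Or.inl (by positivity))

theorem hasLineDerivAt_one_add_norm_sq_rpow {N : ℕ} (s : ℝ) (x : EuclideanSpace ℝ (Fin N))
    (i : Fin N) :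
    HasLineDerivAt ℝ (fun y : EuclideanSpace ℝ (Fin N) => (1 + ‖y‖ ^ 2) ^ s)
      (2 * s * x i * (1 + ‖x‖ ^ 2) ^ (s - 1)) x (EuclideanSpace.single i 1) := by
  have h := (hasFDerivAt_one_add_norm_sq_rpow s x).hasLineDerivAt (EuclideanSpace.single i 1)
  have hv : ((s * (1 + ‖x‖ ^ 2) ^ (s - 1)) • (2 • innerSL ℝ x)) (EuclideanSpace.single i 1) =
      2 * s * x i * (1 + ‖x‖ ^ 2) ^ (s - 1) := by
    simp [EuclideanSpace.inner_single_right]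
    ring
  rwa [hv] at h

theorem pd_w0 (N : ℕ) (i : Fin N) (x : EuclideanSpace ℝ (Fin N)) :
    pd i (w0 N) x = -(((N : ℝ) * ((N : ℝ) - 2)) ^ (((N : ℝ) - 2) / 4) * ((N : ℝ) - 2) *
      x i * (1 + ‖x‖ ^ 2) ^ (-((N : ℝ) / 2))) := by
  have h := (hasFDerivAt_one_add_norm_sq_rpow (-(((N : ℝ) - 2) / 2)) x).const_mul
    (((N : ℝ) * ((N : ℝ) - 2)) ^ (((N : ℝ) - 2) / 4))
  rw [pd, show w0 N = _ from rfl]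
  unfold w0
  rw [h.fderiv, show -(((N : ℝ) - 2) / 2) - 1 = -((N : ℝ) / 2) by ring]
  simp [EuclideanSpace.inner_single_right]
  ring

theorem pd_w0_sq (N : ℕ) (i : Fin N) (x : EuclideanSpace ℝ (Fin N)) :
    (pd i (w0 N) x) ^ 2 =
      (((N : ℝ) * ((N : ℝ) - 2)) ^ (((N : ℝ) - 2) / 4) * ((N : ℝ) - 2)) ^ 2 *
      (x i ^ 2 * (1 + ‖x‖ ^ 2) ^ (-(N : ℝ))) := by
  have h : (1 + ‖x‖ ^ 2) ^ (-(N : ℝ)) = ((1 + ‖x‖ ^ 2) ^ (-((N : ℝ) / 2))) ^ 2 := by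
    rw [← Real.rpow_mul_natCast (by positivity)]
    congr 1
    push_cast
    ring
  rw [pd_w0, h]
  ring

theorem w0_rpow_critical {N : ℕ} (hN : 2 < N) (x : EuclideanSpace ℝ (Fin N)) :
    w0 N x ^ (2 * (N : ℝ) / ((N : ℝ) - 2)) =
      (((N : ℝ) * ((N : ℝ) - 2)) ^ (((N : ℝ) - 2) / 4)) ^ 2 * ((N : ℝ) * ((N : ℝ) - 2)) *
      (1 + ‖x‖ ^ 2) ^ (-(N : ℝ)) := by
  have hN' : (2 : ℝ) < N := by exact_mod_cast hN
  have h2 : (0 : ℝ) < (N : ℝ) - 2 := by linarith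
  have hc : 0 < (N : ℝ) * ((N : ℝ) - 2) := by positivity
  rw [w0, Real.mul_rpow (by positivity) (by positivity), ← Real.rpow_mul hc.le,
    ← Real.rpow_mul (by positivity), ← Real.rpow_mul_natCast hc.le]
  congr 1
  · rw [← Real.rpow_add_one hc.ne']
    congr 1
    push_cast
    field_simp
    ring
  · congr 1
    field_simp

theorem sq_coord_le_norm_sq {N : ℕ} (x : EuclideanSpace ℝ (Fin N)) (i : Fin N) :
    x i ^ 2 ≤ ‖x‖ ^ 2 := by
  rw [EuclideanSpace.real_norm_sq_eq]
  exact Finset.single_le_sum (f := fun j => x j ^ 2) (fun j _ => sq_nonneg _) (Finset.mem_univ i)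

theorem abs_max_coord_le {N : ℕ} (x : EuclideanSpace ℝ (Fin N)) (l : Fin N) :
    |max (x l) 0| ≤ 1 + ‖x‖ ^ 2 := by
  have := sq_coord_le_norm_sq x l
  rw [abs_of_nonneg (le_max_right _ _)]
  refine max_le ?_ (by positivity)
  nlinarith [sq_nonneg (x l - 1)]

theorem abs_coord_mul_max_coord_le {N : ℕ} (x : EuclideanSpace ℝ (Fin N)) (i l : Fin N) :
    |x i * max (x l) 0| ≤ 1 + ‖x‖ ^ 2 := by
  have hi := sq_coord_le_norm_sq x i
  have hl := sq_coord_le_norm_sq x l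
  have hm : |max (x l) 0| ≤ |x l| := by
    rw [abs_of_nonneg (le_max_right _ _)]
    exact max_le (le_abs_self _) (abs_nonneg _)
  rw [abs_mul]
  have := mul_le_mul_of_nonneg_left hm (abs_nonneg (x i))
  nlinarith [sq_nonneg (|x i| - |x l|), sq_abs (x i), sq_abs (x l)]

theorem integrable_of_abs_le_rpow {N : ℕ} (hN : 5 ≤ N) {f : EuclideanSpace ℝ (Fin N) → ℝ}
    (hf : Continuous f) (h : ∀ x, |f x| ≤ (1 + ‖x‖ ^ 2) ^ (2 - (N : ℝ))) : Integrable f := by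
  have hN' : (5 : ℝ) ≤ N := by exact_mod_cast hN
  have hi : Integrable (fun x : EuclideanSpace ℝ (Fin N) => (1 + ‖x‖ ^ 2) ^ (2 - (N : ℝ))) := by
    have := integrable_rpow_neg_one_add_norm_sq (E := EuclideanSpace ℝ (Fin N))
      (μ := volume) (r := 2 * (N : ℝ) - 4) (by rw [finrank_euclideanSpace_fin]; linarith)
    convert this using 3
    ring
  exact hi.mono' hf.aestronglyMeasurable (Eventually.of_forall h)

theorem continuous_one_add_norm_sq_rpow {E : Type*} [NormedAddCommGroup E] (s : ℝ) :
    Continuous (fun x : E => (1 + ‖x‖ ^ 2) ^ s) :=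
  Continuous.rpow_const (by fun_prop) fun x => Or.inl (by positivity)

theorem integrable_mul_rpow_one_sub {N : ℕ} (hN : 5 ≤ N) {f : EuclideanSpace ℝ (Fin N) → ℝ}
    (hf : Continuous f) (h : ∀ x, |f x| ≤ 1 + ‖x‖ ^ 2) :
    Integrable (fun x => f x * (1 + ‖x‖ ^ 2) ^ (1 - (N : ℝ))) := by
  refine integrable_of_abs_le_rpow hN (hf.mul (continuous_one_add_norm_sq_rpow _)) fun x => ?_
  have hp : 0 < 1 + ‖x‖ ^ 2 := by positivity
  rw [abs_mul, abs_of_nonneg (Real.rpow_nonneg hp.le _),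
    show (2 - (N : ℝ)) = 1 + (1 - N) by ring, Real.rpow_add hp, Real.rpow_one]
  exact mul_le_mul_of_nonneg_right (h x) (by positivity)

theorem integrable_max_mul_sq_mul_rpow_neg {N : ℕ} (hN : 5 ≤ N) (l i : Fin N) :
    Integrable (fun x : EuclideanSpace ℝ (Fin N) =>
      max (x l) 0 * x i ^ 2 * (1 + ‖x‖ ^ 2) ^ (-(N : ℝ))) := by
  refine integrable_of_abs_le_rpow hN
    (Continuous.mul (by fun_prop) (continuous_one_add_norm_sq_rpow _)) fun x => ?_
  have hp : 0 < 1 + ‖x‖ ^ 2 := by positivity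
  rw [abs_mul, abs_mul, abs_of_nonneg (Real.rpow_nonneg hp.le _),
    show (2 - (N : ℝ)) = 1 + 1 + -N by ring, Real.rpow_add hp, Real.rpow_add hp, Real.rpow_one]
  refine mul_le_mul_of_nonneg_right ?_ (by positivity)
  refine mul_le_mul (abs_max_coord_le x l) ?_ (abs_nonneg _) hp.le
  rw [abs_of_nonneg (sq_nonneg _)]
  linarith [sq_coord_le_norm_sq x i]

theorem hasLineDerivAt_coord_mul_max {N : ℕ} (l i : Fin N) (x : EuclideanSpace ℝ (Fin N)) :
    HasLineDerivAt ℝ (fun y : EuclideanSpace ℝ (Fin N) => y i * max (y l) 0)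
      ((if i = l then 2 else 1) * max (x l) 0) x (EuclideanSpace.single i 1) := by
  have ht : HasDerivAt (fun t : ℝ => x i + t) 1 0 := (hasDerivAt_id (0 : ℝ)).const_add (x i)
  unfold HasLineDerivAt
  split_ifs with h
  · subst h
    have h' := hasDerivAt_mul_max_zero (x i + 0)
    simpa [Function.comp_def] using h'.comp (0 : ℝ) ht
  · simpa [Ne.symm h] using ht.mul_const (max (x l) 0)

/-- Integrating the `i`-th derivative of `x i * max (x l) 0 * (1 + ‖x‖ ^ 2) ^ (1 - N)`. -/
theorem integral_max_mul_sq_mul_rpow_neg {N : ℕ} (hN : 5 ≤ N) (l i : Fin N) :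
    2 * ((N : ℝ) - 1) * ∫ x : EuclideanSpace ℝ (Fin N),
        max (x l) 0 * x i ^ 2 * (1 + ‖x‖ ^ 2) ^ (-(N : ℝ)) =
      (if i = l then 2 else 1) * ∫ x : EuclideanSpace ℝ (Fin N),
        max (x l) 0 * (1 + ‖x‖ ^ 2) ^ (1 - (N : ℝ)) := by
  have hg (x : EuclideanSpace ℝ (Fin N)) :
      ContinuousLinearMap.mul ℝ ℝ (x i * max (x l) 0)
        (2 * (1 - (N : ℝ)) * x i * (1 + ‖x‖ ^ 2) ^ (1 - (N : ℝ) - 1)) =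
      (2 * (1 - (N : ℝ))) * (max (x l) 0 * x i ^ 2 * (1 + ‖x‖ ^ 2) ^ (-(N : ℝ))) := by
    rw [ContinuousLinearMap.mul_apply', show 1 - (N : ℝ) - 1 = -N by ring]
    ring
  have hf (x : EuclideanSpace ℝ (Fin N)) :
      ContinuousLinearMap.mul ℝ ℝ ((if i = l then 2 else 1) * max (x l) 0)
        ((1 + ‖x‖ ^ 2) ^ (1 - (N : ℝ))) =
      (if i = l then 2 else 1) * (max (x l) 0 * (1 + ‖x‖ ^ 2) ^ (1 - (N : ℝ))) := by
    rw [ContinuousLinearMap.mul_apply', mul_assoc]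
  have key := integral_bilinear_hasLineDerivAt_right_eq_neg_left_of_integrable
    (μ := (volume : Measure (EuclideanSpace ℝ (Fin N)))) (B := ContinuousLinearMap.mul ℝ ℝ)
    (by
      simp_rw [hf]
      exact (integrable_mul_rpow_one_sub hN (by fun_prop)
        fun x => abs_max_coord_le x l).const_mul _)
    (by
      simp_rw [hg]
      exact (integrable_max_mul_sq_mul_rpow_neg hN l i).const_mul _)
    (integrable_mul_rpow_one_sub hN (by fun_prop) fun x => abs_coord_mul_max_coord_le x i l)
    (fun x _ => hasLineDerivAt_coord_mul_max l i x)
    (fun x _ => hasLineDerivAt_one_add_norm_sq_rpow (1 - (N : ℝ)) x i)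
  simp_rw [hf, hg] at key
  rw [integral_const_mul, integral_const_mul] at key
  linarith

theorem integral_upperHalf_coord_mul {N : ℕ} (h : 0 < N) (f : EuclideanSpace ℝ (Fin N) → ℝ) :
    ∫ x in upperHalf N h, x (lastIdx N h) * f x = ∫ x, max (x (lastIdx N h)) 0 * f x := by
  have hm : MeasurableSet (upperHalf N h) :=
    (isOpen_lt continuous_const (by fun_prop)).measurableSet
  rw [← integral_indicator hm]
  congr 1
  ext x
  by_cases hx : x ∈ upperHalf N h
  · rw [Set.indicator_of_mem hx, max_eq_left (le_of_lt hx)]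
  · rw [Set.indicator_of_notMem hx, max_eq_right (not_lt.1 hx), zero_mul]

/-- `𝔄₀ = 2 𝔄₁`, i.e.
`(1/2)∫ ξ_N |∇w₀|² - ((N-2)/(2N)) ∫ ξ_N w₀^{2N/(N-2)} = 2 ∫ ξ_N |∂w₀/∂ξ₁|²`. -/
theorem stmt7 (N : ℕ) (hN : 5 ≤ N) :
    (1 : ℝ) / 2 * (∫ ξ in upperHalf N (by omega),
        ξ (lastIdx N (by omega)) * ∑ i, (pd i (w0 N) ξ) ^ 2)
      - ((N : ℝ) - 2) / (2 * (N : ℝ)) * (∫ ξ in upperHalf N (by omega),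
          ξ (lastIdx N (by omega)) * w0 N ξ ^ (2 * (N : ℝ) / ((N : ℝ) - 2)))
      = 2 * ∫ ξ in upperHalf N (by omega),
          ξ (lastIdx N (by omega)) * (pd (⟨0, by omega⟩ : Fin N) (w0 N) ξ) ^ 2 := by
  have h0 : 0 < N := by omega
  have hN' : (5 : ℝ) ≤ N := by exact_mod_cast hN
  set l := lastIdx N h0
  set z : Fin N := ⟨0, h0⟩
  have hzl : z ≠ l := by
    intro h
    have := congrArg Fin.val h
    simp only [z, l, lastIdx] at this
    omega
  set α : ℝ := ((N : ℝ) * ((N : ℝ) - 2)) ^ (((N : ℝ) - 2) / 4)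
  set I : Fin N → ℝ := fun i => ∫ x : EuclideanSpace ℝ (Fin N),
    max (x l) 0 * x i ^ 2 * (1 + ‖x‖ ^ 2) ^ (-(N : ℝ)) with hI
  set J : ℝ := ∫ x : EuclideanSpace ℝ (Fin N), max (x l) 0 * (1 + ‖x‖ ^ 2) ^ (1 - (N : ℝ)) with hJ
  have hIJ (i : Fin N) : 2 * ((N : ℝ) - 1) * I i = (if i = l then 2 else 1) * J :=
    integral_max_mul_sq_mul_rpow_neg hN l i
  have hint (i : Fin N) := integrable_max_mul_sq_mul_rpow_neg hN l i
  have hsum : 2 * ((N : ℝ) - 1) * ∑ i, I i = (N + 1) * J := by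
    have hc : ∑ i : Fin N, (if i = l then (2 : ℝ) else 1) = N + 1 := by
      have (i : Fin N) : (if i = l then (2 : ℝ) else 1) = 1 + if i = l then 1 else 0 := by
        split_ifs <;> norm_num
      simp [this, Finset.sum_add_distrib]
    rw [Finset.mul_sum, Finset.sum_congr rfl fun i _ => hIJ i, ← Finset.sum_mul, hc]
  have hgrad : ∫ x in upperHalf N h0, x l * ∑ i, (pd i (w0 N) x) ^ 2 =
      (α * ((N : ℝ) - 2)) ^ 2 * ∑ i, I i := by
    rw [integral_upperHalf_coord_mul, hI, ← integral_finsetSum _ fun i _ => hint i,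
      ← integral_const_mul]
    congr 1
    ext x
    rw [Finset.mul_sum, Finset.mul_sum]
    refine Finset.sum_congr rfl fun i _ => ?_
    rw [pd_w0_sq]
    ring
  have hpot : ∫ x in upperHalf N h0, x l * w0 N x ^ (2 * (N : ℝ) / ((N : ℝ) - 2)) =
      α ^ 2 * ((N : ℝ) * ((N : ℝ) - 2)) * (J - ∑ i, I i) := by
    rw [integral_upperHalf_coord_mul, hI, ← integral_finsetSum _ fun i _ => hint i, hJ,
      ← integral_sub (integrable_mul_rpow_one_sub hN (by fun_prop) fun x => abs_max_coord_le x l)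
        (integrable_finsetSum _ fun i _ => hint i), ← integral_const_mul]
    congr 1
    ext x
    have hp : 0 < 1 + ‖x‖ ^ 2 := by positivity
    rw [w0_rpow_critical (by omega), sub_eq_add_neg 1 (N : ℝ), Real.rpow_add hp, Real.rpow_one,
      ← Finset.sum_mul, ← Finset.mul_sum, ← EuclideanSpace.real_norm_sq_eq]
    ring
  have hpd : ∫ x in upperHalf N h0, x l * (pd z (w0 N) x) ^ 2 =
      (α * ((N : ℝ) - 2)) ^ 2 * I z := by
    rw [integral_upperHalf_coord_mul, hI, ← integral_const_mul]
    congr 1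
    ext x
    rw [pd_w0_sq]
    ring
  rw [hgrad, hpot, hpd]
  have hz := hIJ z
  rw [if_neg hzl, one_mul] at hz
  have hmain : 2 * ∑ i, I i - J = 4 * I z := by
    have hne : 2 * ((N : ℝ) - 1) ≠ 0 := by
      have : (0 : ℝ) < (N : ℝ) - 1 := by linarith
      positivity
    apply mul_left_cancel₀ hne
    linear_combination 2 * hsum - 4 * hz
  have hNne : (N : ℝ) ≠ 0 := by positivity
  field_simp
  linear_combination (α ^ 2 * ((N : ℝ) - 2) ^ 2) * hmain
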